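/- arXiv:0805.0375 — 2 statements merged into one kernel-verified Lean document; each statement's English description precedes it below -/
import Mathlib

section
/- Let C_L ≥ 0 and γ_CD > 0 be real numbers with C_L ≤ C(γ_CD), and set α₁ = (1 − 2^{−C_L})/(1 − 1/(1 + γ_CD)). Then 0 ≤ α₁ ≤ 1, log₂(1 + α₁γ_CD/(1 + (1−α₁)γ_CD)) = C_L, and log₂(1 + (1−α₁)γ_CD) = C(γ_CD) − C_L. -/
/-- Gaussian point-to-point capacity function: C(x) = log₂(1+x). -/
noncomputable def gc (x : ℝ) : ℝ := Real.logb 2 (1 + x)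

theorem stmt_10 (C_L γ_CD : ℝ) (hC : 0 ≤ C_L) (hCD : 0 < γ_CD)
    (h : C_L ≤ gc γ_CD)
    (α₁ : ℝ) (hα : α₁ = (1 - (2 : ℝ) ^ (-C_L)) / (1 - 1 / (1 + γ_CD))) :
    (0 ≤ α₁ ∧ α₁ ≤ 1) ∧
    Real.logb 2 (1 + α₁ * γ_CD / (1 + (1 - α₁) * γ_CD)) = C_L ∧
    Real.logb 2 (1 + (1 - α₁) * γ_CD) = gc γ_CD - C_L := by
  have hγ : 0 < 1 + γ_CD := by linarith
  set t : ℝ := (2 : ℝ) ^ (-C_L) with ht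
  have ht0 : 0 < t := Real.rpow_pos_of_pos two_pos _
  have hlog : Real.logb 2 t = -C_L := Real.logb_rpow two_pos (by norm_num)
  have ht1 : t ≤ 1 := Real.rpow_le_one_of_one_le_of_nonpos one_le_two (by linarith)
  have htγ : 1 ≤ t * (1 + γ_CD) := by
    rw [← Real.logb_nonneg_iff one_lt_two (by positivity),
      Real.logb_mul ht0.ne' hγ.ne', hlog]
    unfold gc at h
    linarith
  have hαγ : α₁ * γ_CD = (1 - t) * (1 + γ_CD) := by
    have hd : 1 - 1 / (1 + γ_CD) = γ_CD / (1 + γ_CD) := by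
      field_simp
      ring
    rw [hα, hd]
    field_simp
  have hrem : 1 + (1 - α₁) * γ_CD = t * (1 + γ_CD) := by linarith
  refine ⟨⟨?_, ?_⟩, ?_, ?_⟩
  · refine nonneg_of_mul_nonneg_left ?_ hCD
    rw [hαγ]
    exact mul_nonneg (by linarith) hγ.le
  · exact le_of_mul_le_mul_right (by linarith) hCD
  · have hinv : 1 + α₁ * γ_CD / (1 + (1 - α₁) * γ_CD) = t⁻¹ := by
      rw [hrem, hαγ]
      field_simp
      ring
    rw [hinv, Real.logb_inv, hlog, neg_neg]
  · rw [hrem, Real.logb_mul ht0.ne' hγ.ne', hlog, gc]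
    ring
end

section
/- Let C_L ≥ 0, γ_CD > 0 with C_L ≤ C(γ_CD), let γ_AB ≥ 0, γ_CB ≥ 0, and let t be any real number. With α₂ = 1 − (2^{C_L} − 1)/γ_CD and α₁ = (1 − 2^{−C_L})/(1 − 1/(1 + γ_CD)), the inequality min{ C(γ_AB), C(γ_AB + α₂·γ_CB) − t } ≥ min{ C(γ_AB), C(γ_AB + (1−α₁)·γ_CB) − t } holds. (Hence, in the regime of low downlink rate where the residual superposed message is decodable at B, sending the message decoded last over the backbone yields the higher achievable uplink rate.) -/
theorem stmt_13 (C_L γ_CD γ_AB γ_CB t : ℝ) (hC : 0 ≤ C_L) (hCD : 0 < γ_CD)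
    (h : C_L ≤ gc γ_CD) (hAB : 0 ≤ γ_AB) (hCB : 0 ≤ γ_CB)
    (α₂ α₁ : ℝ) (hα₂ : α₂ = 1 - ((2 : ℝ) ^ C_L - 1) / γ_CD)
    (hα₁ : α₁ = (1 - (2 : ℝ) ^ (-C_L)) / (1 - 1 / (1 + γ_CD))) :
    min (gc γ_AB) (gc (γ_AB + (1 - α₁) * γ_CB) - t) ≤
      min (gc γ_AB) (gc (γ_AB + α₂ * γ_CB) - t) := by
  have hu : (2 : ℝ) ^ C_L ≤ 1 + γ_CD :=
    (Real.le_logb_iff_rpow_le one_lt_two (by linarith)).1 h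
  have hu1 : 1 ≤ (2 : ℝ) ^ C_L := Real.one_le_rpow one_le_two hC
  rw [Real.rpow_neg zero_le_two] at hα₁
  generalize (2 : ℝ) ^ C_L = u at *
  have hu0 : 0 < u := by linarith
  have hα₂_nonneg : 0 ≤ α₂ := by
    rw [hα₂, sub_nonneg, div_le_one hCD]
    linarith
  have hrel : 1 - α₁ = α₂ / u := by
    have hg : 1 + γ_CD ≠ 0 := by linarith
    have hd : 1 - 1 / (1 + γ_CD) = γ_CD / (1 + γ_CD) := by
      field_simp
      ring
    rw [hα₁, hα₂, hd]
    field_simp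
    ring
  have hnonneg : 0 ≤ 1 - α₁ := hrel ▸ div_nonneg hα₂_nonneg hu0.le
  have hle : 1 - α₁ ≤ α₂ := hrel ▸ div_le_self hα₂_nonneg hu1
  have hmul : (1 - α₁) * γ_CB ≤ α₂ * γ_CB := mul_le_mul_of_nonneg_right hle hCB
  have hmul_nonneg : 0 ≤ (1 - α₁) * γ_CB := mul_nonneg hnonneg hCB
  refine min_le_min le_rfl (sub_le_sub_right ?_ t)
  exact Real.logb_le_logb_of_le one_lt_two (by linarith) (by linarith)
end
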